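/- arXiv:2308.16189 — 2 statements merged into one kernel-verified Lean document; each statement's English description precedes it below -/
import Mathlib

section
/- Let 0 < ρ < 1 and λ ∈ ℂ. Then for every t > 0 the Caputo derivative of order ρ of the function t ↦ t^ρ E^2_{ρ,ρ+1}(λ t^ρ) equals E^2_{ρ,1}(λ t^ρ), i.e. D_t^ρ ( t^ρ E^2_{ρ,ρ+1}(λ t^ρ) ) = E^2_{ρ,1}(λ t^ρ). -/
open intervalIntegral

/-- The Prabhakar (three-parameter Mittag-Leffler) function
`E^γ_{ρ,μ}(z) = ∑_{k=0}^∞ ((γ)_k / (Γ(ρk + μ) k!)) z^k`, where `(γ)_k = Γ(γ+k)/Γ(γ)`. -/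
noncomputable def prabhakar (ρ μ γ : ℝ) (z : ℂ) : ℂ :=
  ∑' k : ℕ, (((Real.Gamma (γ + k) / Real.Gamma γ) : ℝ) : ℂ) /
    (((Real.Gamma (ρ * k + μ) : ℝ) : ℂ) * (Nat.factorial k : ℂ)) * z ^ k

/-- The Caputo fractional derivative of order `ρ ∈ (0,1)`:
`D_t^ρ h(t) = (1/Γ(1-ρ)) ∫_0^t (t-ξ)^(-ρ) h'(ξ) dξ`. -/
noncomputable def caputoDeriv {E : Type*} [NormedAddCommGroup E] [NormedSpace ℝ E]
    (ρ : ℝ) (h : ℝ → E) (t : ℝ) : E :=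
  (1 / Real.Gamma (1 - ρ)) • ∫ ξ in (0:ℝ)..t, ((t - ξ) ^ (-ρ) : ℝ) • deriv h ξ

open MeasureTheory Filter Set

/-- A lower bound for the growth of `Γ` over a step `r`, from log-convexity. -/
lemma Real.Gamma_mul_rpow_le_Gamma_add {r y : ℝ} (hr : 0 < r) (hy : 1 < y) :
    Real.Gamma y * (y - 1) ^ r ≤ Real.Gamma (y + r) := by
  have h1 : 0 < y - 1 := by linarith
  have hG1 := Real.Gamma_pos_of_pos h1
  have hGy := Real.Gamma_pos_of_pos (zero_lt_one.trans hy)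
  have hGr := Real.Gamma_pos_of_pos (show 0 < y + r by linarith)
  have hrec : Real.Gamma y = (y - 1) * Real.Gamma (y - 1) := by
    simpa using Real.Gamma_add_one h1.ne'
  have key := Real.convexOn_log_Gamma.slope_mono_adjacent (x := y - 1) (y := y) (z := y + r)
    (mem_Ioi.2 h1) (mem_Ioi.2 (by linarith)) (by linarith) (by linarith)
  simp only [Function.comp_apply, sub_sub_cancel, div_one, add_sub_cancel_left] at key
  rw [hrec, Real.log_mul h1.ne' hG1.ne', add_sub_cancel_right, ← Real.log_mul h1.ne' hG1.ne',
    ← hrec, le_div_iff₀ hr] at key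
  rw [← Real.log_le_log_iff (by positivity) hGr, Real.log_mul hGy.ne' (by positivity),
    Real.log_rpow h1]
  linarith

/-- Absolute convergence of the series of `E^2_{r,m}`. -/
lemma summable_succ_div_Gamma_mul_pow {r m x : ℝ} (hr : 0 < r) (hm : 0 < m) (hx : 0 ≤ x) :
    Summable fun k : ℕ => ((k : ℝ) + 1) / Real.Gamma (r * k + m) * x ^ k := by
  refine summable_of_ratio_norm_eventually_le (r := 1 / 2) (by norm_num) ?_
  have hlin : Tendsto (fun k : ℕ => r * (k : ℝ) + m - 1) atTop atTop := by
    have h := tendsto_atTop_add_const_right atTop (m - 1)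
      (tendsto_natCast_atTop_atTop (R := ℝ) |>.const_mul_atTop hr)
    simpa only [add_sub_assoc] using h
  filter_upwards [((tendsto_rpow_atTop hr).comp hlin).eventually_ge_atTop (4 * x),
    hlin.eventually_gt_atTop 0] with k hk hk0
  simp only [Function.comp_apply] at hk
  have hG := Real.Gamma_pos_of_pos (show 0 < r * (k : ℝ) + m by linarith)
  have hG' := Real.Gamma_pos_of_pos (show 0 < r * (k : ℝ) + m + r by linarith)
  have hstep := Real.Gamma_mul_rpow_le_Gamma_add hr (show 1 < r * (k : ℝ) + m by linarith)
  have hGx : Real.Gamma (r * k + m) * (4 * x) ≤ Real.Gamma (r * k + m + r) :=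
    (mul_le_mul_of_nonneg_left hk hG.le).trans hstep
  have harg : r * ((k + 1 : ℕ) : ℝ) + m = r * k + m + r := by push_cast; ring
  rw [harg, Real.norm_of_nonneg (by positivity), Real.norm_of_nonneg (by positivity), pow_succ]
  push_cast
  have hx4 : x / Real.Gamma (r * k + m + r) ≤ 1 / (4 * Real.Gamma (r * k + m)) := by
    rw [div_le_div_iff₀ hG' (by positivity)]
    linarith
  calc ((k : ℝ) + 1 + 1) / Real.Gamma (r * k + m + r) * (x ^ k * x)
      = (k + 1 + 1) * x ^ k * (x / Real.Gamma (r * k + m + r)) := by ring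
    _ ≤ (2 * (k + 1)) * x ^ k * (1 / (4 * Real.Gamma (r * k + m))) := by
        gcongr
        linarith [(Nat.cast_nonneg k : (0 : ℝ) ≤ k)]
    _ = 1 / 2 * ((k + 1) / Real.Gamma (r * k + m) * x ^ k) := by
        field_simp
        ring

/-- Euler's beta integral on `[0, t]`. -/
lemma integral_sub_rpow_mul_rpow {r a t : ℝ} (hr : r < 1) (ha : 0 < a) (ht : 0 < t) :
    ∫ x in (0 : ℝ)..t, (t - x) ^ (-r) * x ^ (a - 1) =
      Real.Gamma (1 - r) * Real.Gamma a / Real.Gamma (a + 1 - r) * t ^ (a - r) := by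
  have hC := Complex.betaIntegral_scaled (a : ℂ) ((1 - r : ℝ) : ℂ) ht
  have hB := Complex.Gamma_mul_Gamma_eq_betaIntegral (s := (a : ℂ)) (t := ((1 - r : ℝ) : ℂ))
    (by simpa using ha) (by simpa using hr)
  have hG : Real.Gamma (a + 1 - r) ≠ 0 := (Real.Gamma_pos_of_pos (by linarith)).ne'
  rw [← Complex.ofReal_add, Complex.Gamma_ofReal, Complex.Gamma_ofReal, Complex.Gamma_ofReal,
    ← add_sub_assoc] at hB
  have hβ : Complex.betaIntegral (a : ℂ) ((1 - r : ℝ) : ℂ) =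
      ((Real.Gamma (1 - r) * Real.Gamma a / Real.Gamma (a + 1 - r) : ℝ) : ℂ) := by
    rw [Complex.ofReal_div, Complex.ofReal_mul, eq_div_iff (by exact_mod_cast hG)]
    linear_combination -hB
  have hL : ∫ x in (0 : ℝ)..t, (x : ℂ) ^ ((a : ℂ) - 1) * ((t : ℂ) - x) ^ (((1 - r : ℝ) : ℂ) - 1) =
      ∫ x in (0 : ℝ)..t, (((t - x) ^ (-r) * x ^ (a - 1) : ℝ) : ℂ) := by
    refine intervalIntegral.integral_congr fun x hx => ?_
    rw [uIcc_of_le ht.le] at hx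
    rw [Complex.ofReal_mul, Complex.ofReal_cpow (sub_nonneg.2 hx.2), Complex.ofReal_cpow hx.1,
      mul_comm]
    push_cast
    ring_nf
  rw [hL, intervalIntegral.integral_ofReal, hβ] at hC
  have ht' : (t : ℂ) ^ ((a : ℂ) + ((1 - r : ℝ) : ℂ) - 1) = ((t ^ (a - r) : ℝ) : ℂ) := by
    rw [Complex.ofReal_cpow ht.le]
    push_cast
    ring_nf
  rw [ht'] at hC
  rw [mul_comm]
  exact_mod_cast hC

lemma intervalIntegrable_sub_rpow_mul_rpow {r a t : ℝ} (hr : r < 1) (ha : 0 < a) (ht : 0 < t) :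
    IntervalIntegrable (fun x => (t - x) ^ (-r) * x ^ (a - 1)) volume 0 t := by
  refine intervalIntegral.intervalIntegrable_of_integral_ne_zero ?_
  rw [integral_sub_rpow_mul_rpow hr ha ht]
  have h1 := Real.Gamma_pos_of_pos (show 0 < 1 - r by linarith)
  have h2 := Real.Gamma_pos_of_pos ha
  have h3 := Real.Gamma_pos_of_pos (show 0 < a + 1 - r by linarith)
  positivity

lemma prabhakar_two_eq_tsum (ρ μ : ℝ) (z : ℂ) :
    prabhakar ρ μ 2 z =
      ∑' k : ℕ, ((((k : ℝ) + 1) / Real.Gamma (ρ * k + μ) : ℝ) : ℂ) * z ^ k := by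
  refine tsum_congr fun k => ?_
  have h1 : Real.Gamma (2 + k) = (k + 1) * (Nat.factorial k : ℝ) := by
    rw [show (2 + k : ℝ) = ((k + 1 : ℕ) : ℝ) + 1 by push_cast; ring, Real.Gamma_nat_eq_factorial,
      Nat.factorial_succ]
    push_cast
    ring
  have hk : (Nat.factorial k : ℂ) ≠ 0 := by exact_mod_cast Nat.factorial_ne_zero k
  rw [h1, Real.Gamma_two, div_one]
  push_cast
  rw [mul_div_mul_right _ _ hk]

lemma rpow_mul_prabhakar_two_eq_tsum (ρ μ : ℝ) (lam : ℂ) {s : ℝ} (hs : 0 < s) :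
    ((s ^ ρ : ℝ) : ℂ) * prabhakar ρ μ 2 (lam * ((s ^ ρ : ℝ) : ℂ)) =
      ∑' k : ℕ, ((((k : ℝ) + 1) / Real.Gamma (ρ * k + μ) : ℝ) : ℂ) * lam ^ k *
        ((s ^ (ρ * k + ρ) : ℝ) : ℂ) := by
  rw [prabhakar_two_eq_tsum, ← tsum_mul_left]
  refine tsum_congr fun k => ?_
  rw [Real.rpow_add hs, Real.rpow_mul_natCast hs.le]
  push_cast
  ring

lemma hasDerivAt_rpow_mul_prabhakar_two {ρ : ℝ} (hρ0 : 0 < ρ) (hρ1 : ρ < 1) (lam : ℂ) {s : ℝ}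
    (hs : 0 < s) :
    HasDerivAt (fun s : ℝ => ((s ^ ρ : ℝ) : ℂ) * prabhakar ρ (ρ + 1) 2 (lam * ((s ^ ρ : ℝ) : ℂ)))
      (∑' k : ℕ, ((((k : ℝ) + 1) / Real.Gamma (ρ * k + ρ) : ℝ) : ℂ) * lam ^ k *
        ((s ^ (ρ * k + ρ - 1) : ℝ) : ℂ)) s := by
  have hmem : s ∈ Ioo (s / 2) (2 * s) := ⟨by linarith, by linarith⟩
  have hG (k : ℕ) : 0 < Real.Gamma (ρ * k + ρ) := Real.Gamma_pos_of_pos (by positivity)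
  have hG' (k : ℕ) : 0 < Real.Gamma (ρ * k + (ρ + 1)) := Real.Gamma_pos_of_pos (by positivity)
  have hmain := hasDerivAt_tsum_of_isPreconnected (𝕜 := ℝ)
    (g := fun (k : ℕ) (s : ℝ) => ((((k : ℝ) + 1) / Real.Gamma (ρ * k + (ρ + 1)) : ℝ) : ℂ) * lam ^ k *
        ((s ^ (ρ * k + ρ) : ℝ) : ℂ))
    (g' := fun (k : ℕ) (s : ℝ) => ((((k : ℝ) + 1) / Real.Gamma (ρ * k + ρ) : ℝ) : ℂ) * lam ^ k *
        ((s ^ (ρ * k + ρ - 1) : ℝ) : ℂ))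
    (u := fun k : ℕ => ((k : ℝ) + 1) / Real.Gamma (ρ * k + ρ) * (‖lam‖ * (2 * s) ^ ρ) ^ k *
        (s / 2) ^ (ρ - 1))
    (t := Ioo (s / 2) (2 * s)) (y₀ := s) (y := s)
    ((summable_succ_div_Gamma_mul_pow hρ0 hρ0 (by positivity)).mul_right _)
    isOpen_Ioo isPreconnected_Ioo ?_ ?_ hmem ?_ hmem
  · refine hmain.congr_of_eventuallyEq ?_
    filter_upwards [Ioi_mem_nhds hs] with y hy
    exact rpow_mul_prabhakar_two_eq_tsum ρ (ρ + 1) lam hy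
  · intro k y hy
    have hy0 : 0 < y := by linarith [hy.1]
    have hd := ((Real.hasDerivAt_rpow_const (p := ρ * k + ρ) (Or.inl hy0.ne')).ofReal_comp).const_mul
      (((((k : ℝ) + 1) / Real.Gamma (ρ * k + (ρ + 1)) : ℝ) : ℂ) * lam ^ k)
    refine hd.congr_deriv ?_
    have hpos : 0 < ρ * k + ρ := by positivity
    have hne : ((ρ * k + ρ : ℝ) : ℂ) ≠ 0 := by exact_mod_cast hpos.ne'
    have hGne : (Real.Gamma (ρ * k + ρ) : ℂ) ≠ 0 := by exact_mod_cast (hG k).ne'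
    rw [← add_assoc, Real.Gamma_add_one hpos.ne']
    rw [show ((k : ℝ) + 1) / Real.Gamma (ρ * k + ρ) =
      ((k : ℝ) + 1) / ((ρ * k + ρ) * Real.Gamma (ρ * k + ρ)) * (ρ * k + ρ) by
        have := (hG k).ne'
        field_simp]
    rw [Complex.ofReal_mul, Complex.ofReal_mul]
    ring
  · intro k y hy
    have hy0 : 0 < y := by linarith [hy.1]
    have hGk := hG k
    rw [norm_mul, norm_mul, norm_pow, Complex.norm_of_nonneg (by positivity),
      Complex.norm_of_nonneg (by positivity), add_sub_assoc, Real.rpow_add hy0,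
      Real.rpow_mul_natCast hy0.le, mul_pow, ← mul_assoc, ← mul_assoc]
    gcongr ?_ * ?_ ^ k * ?_
    · exact Real.rpow_le_rpow hy0.le hy.2.le hρ0.le
    · exact Real.rpow_le_rpow_of_nonpos (by positivity) hy.1.le (by linarith)
  · refine Summable.of_norm ?_
    refine ((summable_succ_div_Gamma_mul_pow (m := ρ + 1) (x := ‖lam‖ * s ^ ρ) hρ0 (by positivity)
      (by positivity)).mul_right (s ^ ρ)).congr fun k => ?_
    have hGk := hG' k
    rw [norm_mul, norm_mul, norm_pow, Complex.norm_of_nonneg (by positivity),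
      Complex.norm_of_nonneg (by positivity), Real.rpow_add hs, Real.rpow_mul_natCast hs.le]
    ring

/-- **Lemma 3.4, second identity**: for `0 < ρ < 1`, `λ ∈ ℂ` and `t > 0`,
`D_t^ρ ( t^ρ E^2_{ρ,ρ+1}(λ t^ρ) ) = E^2_{ρ,1}(λ t^ρ)`. -/
theorem caputoDeriv_prabhakar (ρ : ℝ) (hρ0 : 0 < ρ) (hρ1 : ρ < 1) (lam : ℂ)
    (t : ℝ) (ht : 0 < t) :
    caputoDeriv ρ
        (fun s => ((s ^ ρ : ℝ) : ℂ) * prabhakar ρ (ρ + 1) 2 (lam * ((s ^ ρ : ℝ) : ℂ))) t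
      = prabhakar ρ 1 2 (lam * ((t ^ ρ : ℝ) : ℂ)) := by
  have hG (k : ℕ) : 0 < Real.Gamma (ρ * k + ρ) := Real.Gamma_pos_of_pos (by positivity)
  have hG1 (k : ℕ) : 0 < Real.Gamma (ρ * k + 1) := Real.Gamma_pos_of_pos (by positivity)
  have hGρ : 0 < Real.Gamma (1 - ρ) := Real.Gamma_pos_of_pos (by linarith)
  set c : ℕ → ℂ := fun k => ((((k : ℝ) + 1) / Real.Gamma (ρ * k + ρ) : ℝ) : ℂ) * lam ^ k with hc
  set w : ℕ → ℝ → ℝ := fun k ξ => (t - ξ) ^ (-ρ) * ξ ^ (ρ * k + ρ - 1) with hw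
  have hwint (k : ℕ) : ∫ ξ in Ioc 0 t, w k ξ =
      Real.Gamma (1 - ρ) * Real.Gamma (ρ * k + ρ) / Real.Gamma (ρ * k + 1) * (t ^ ρ) ^ k := by
    rw [← intervalIntegral.integral_of_le ht.le,
      integral_sub_rpow_mul_rpow hρ1 (show 0 < ρ * (k : ℝ) + ρ by positivity) ht,
      ← Real.rpow_mul_natCast ht.le]
    ring_nf
  have hwI (k : ℕ) : Integrable (w k) (volume.restrict (Ioc 0 t)) :=
    (intervalIntegrable_iff_integrableOn_Ioc_of_le ht.le).1
      (intervalIntegrable_sub_rpow_mul_rpow hρ1 (show 0 < ρ * (k : ℝ) + ρ by positivity) ht)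
  have hnorm (k : ℕ) : ∫ ξ in Ioc 0 t, ‖c k * (w k ξ : ℂ)‖ =
      ((k : ℝ) + 1) / Real.Gamma (ρ * k + 1) * (‖lam‖ * t ^ ρ) ^ k * Real.Gamma (1 - ρ) := by
    have hGk := hG k
    have hGk1 := hG1 k
    have hck : ‖c k‖ = ((k : ℝ) + 1) / Real.Gamma (ρ * k + ρ) * ‖lam‖ ^ k := by
      rw [hc, norm_mul, norm_pow, Complex.norm_of_nonneg (by positivity)]
    have hcongr : ∫ ξ in Ioc 0 t, ‖c k * (w k ξ : ℂ)‖ = ∫ ξ in Ioc 0 t, ‖c k‖ * w k ξ := by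
      refine setIntegral_congr_fun measurableSet_Ioc fun ξ hξ => ?_
      have h1 : 0 ≤ t - ξ := sub_nonneg.2 hξ.2
      have h2 : 0 ≤ ξ := hξ.1.le
      rw [norm_mul, Complex.norm_of_nonneg (by positivity)]
    rw [hcongr, MeasureTheory.integral_const_mul, hwint, hck, mul_pow]
    field_simp
  have hsum := hasSum_integral_of_summable_integral_norm
    (μ := volume.restrict (Ioc 0 t)) (F := fun (k : ℕ) (ξ : ℝ) => c k * (w k ξ : ℂ))
    (fun k => (hwI k).ofReal.const_mul (c k))
    (((summable_succ_div_Gamma_mul_pow hρ0 one_pos (by positivity)).mul_right _).congr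
      fun k => (hnorm k).symm)
  have hintegrand : ∫ ξ in (0 : ℝ)..t, ((t - ξ) ^ (-ρ) : ℝ) • deriv (fun s : ℝ => ((s ^ ρ : ℝ) : ℂ) *
      prabhakar ρ (ρ + 1) 2 (lam * ((s ^ ρ : ℝ) : ℂ))) ξ =
      ∫ ξ in Ioc 0 t, ∑' k : ℕ, c k * (w k ξ : ℂ) := by
    rw [intervalIntegral.integral_of_le ht.le]
    refine setIntegral_congr_fun measurableSet_Ioc fun ξ hξ => ?_
    rw [(hasDerivAt_rpow_mul_prabhakar_two hρ0 hρ1 lam hξ.1).deriv, Complex.real_smul,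
      ← tsum_mul_left]
    refine tsum_congr fun k => ?_
    simp only [hc, hw, Complex.ofReal_mul]
    ring
  rw [caputoDeriv, hintegrand, ← hsum.tsum_eq, prabhakar_two_eq_tsum, Complex.real_smul,
    ← tsum_mul_left]
  refine tsum_congr fun k => ?_
  have hGk : (Real.Gamma (ρ * k + ρ) : ℂ) ≠ 0 := by exact_mod_cast (hG k).ne'
  have hGk1 : (Real.Gamma (ρ * k + 1) : ℂ) ≠ 0 := by exact_mod_cast (hG1 k).ne'
  have hGρ' : (Real.Gamma (1 - ρ) : ℂ) ≠ 0 := by exact_mod_cast hGρ.ne'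
  rw [MeasureTheory.integral_const_mul, integral_complex_ofReal, hwint, hc, mul_pow]
  push_cast
  generalize (Real.Gamma (ρ * k + ρ) : ℂ) = g at hGk ⊢
  field_simp
end

section
/- Let 0 < ρ < 1, α > 0, T > 0, let H be a separable complex Hilbert space, and let g : [0,T] → H be continuous. Define h(t) = ∫_0^t (t−τ)^{2ρ−1} E^2_{ρ,2ρ}(−α (t−τ)^ρ) g(τ) dτ (a Bochner integral with scalar kernel). Then there exists C > 0 (depending only on ρ, α, T) such that for all t ∈ [0,T]: ‖h(t)‖ ≤ C max_{0≤s≤T} ‖g(s)‖ and ‖J_t^{−ρ} h(t)‖ ≤ C max_{0≤s≤T} ‖g(s)‖. -/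
open intervalIntegral

/-- The (Riemann–Liouville) fractional integral of order `ρ` of an `H`-valued function:
`J_t^{-ρ} h(t) = (1/Γ(ρ)) ∫_0^t (t-ξ)^(ρ-1) h(ξ) dξ` (Bochner integral). -/
noncomputable def fracInt {E : Type*} [NormedAddCommGroup E] [NormedSpace ℝ E]
    (ρ : ℝ) (h : ℝ → E) (t : ℝ) : E :=
  (1 / Real.Gamma ρ) • ∫ ξ in (0:ℝ)..t, ((t - ξ) ^ (ρ - 1) : ℝ) • h ξ

/-- An elementary lower bound showing that `Γ` grows faster than any exponential. -/
theorem rpow_mul_exp_neg_le_Gamma {M x : ℝ} (hM : 0 < M) (hx : 1 ≤ x) :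
    M ^ (x - 1) * Real.exp (-M) ≤ Real.Gamma x := by
  have hint := Real.GammaIntegral_convergent (s := x) (by linarith)
  have hsub : Set.Ioi M ⊆ Set.Ioi (0 : ℝ) := Set.Ioi_subset_Ioi hM.le
  calc M ^ (x - 1) * Real.exp (-M)
      = ∫ t in Set.Ioi M, M ^ (x - 1) * Real.exp (-t) := by
        rw [MeasureTheory.integral_const_mul, integral_exp_neg_Ioi]
    _ ≤ ∫ t in Set.Ioi M, Real.exp (-t) * t ^ (x - 1) := by
        refine MeasureTheory.setIntegral_mono_on ?_ (hint.mono_set hsub) measurableSet_Ioi ?_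
        · exact (integrableOn_exp_neg_Ioi M).const_mul _
        · intro t ht
          rw [mul_comm]
          exact mul_le_mul_of_nonneg_left
            (Real.rpow_le_rpow hM.le (le_of_lt ht) (by linarith)) (Real.exp_pos _).le
    _ ≤ ∫ t in Set.Ioi 0, Real.exp (-t) * t ^ (x - 1) := by
        refine MeasureTheory.setIntegral_mono_set hint ?_ hsub.eventuallyLE
        filter_upwards [MeasureTheory.self_mem_ae_restrict measurableSet_Ioi] with t ht
        exact mul_nonneg (Real.exp_pos _).le (Real.rpow_nonneg (le_of_lt ht) _)
    _ = Real.Gamma x := (Real.Gamma_eq_integral (by linarith)).symm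

theorem summable_mul_pow_div_Gamma {ρ : ℝ} (hρ : 0 < ρ) (μ : ℝ) {R : ℝ} (hR : 0 < R) :
    Summable fun k : ℕ => ((k : ℝ) + 1) * R ^ k / |Real.Gamma (ρ * k + μ)| := by
  set M : ℝ := (2 * R) ^ (ρ⁻¹) with hM_def
  have hM : 0 < M := by positivity
  have hMρ : M ^ ρ = 2 * R := by
    rw [hM_def, ← Real.rpow_mul (by positivity), inv_mul_cancel₀ hρ.ne', Real.rpow_one]
  have hgeom : Summable fun k : ℕ => ((k : ℝ) + 1) * (1 / 2 : ℝ) ^ k := by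
    have h1 : Summable fun k : ℕ => (k : ℝ) * (1 / 2 : ℝ) ^ k := by
      simpa using summable_pow_mul_geometric_of_norm_lt_one (R := ℝ) 1
        (r := 1 / 2) (by norm_num)
    have h0 : Summable fun k : ℕ => (1 / 2 : ℝ) ^ k :=
      summable_geometric_of_lt_one (by norm_num) (by norm_num)
    simpa only [add_mul, one_mul] using h1.add h0
  refine Summable.of_norm_bounded_eventually_nat
    (hgeom.mul_left (M ^ (μ - 1) * Real.exp (-M))⁻¹) ?_
  obtain ⟨N, hN⟩ := exists_nat_ge ((1 - μ) / ρ)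
  filter_upwards [Filter.eventually_ge_atTop N] with k hk
  have hx : 1 ≤ ρ * k + μ := by
    have : (1 - μ) / ρ ≤ k := hN.trans (by exact_mod_cast hk)
    rw [div_le_iff₀ hρ] at this
    linarith
  have hpow : M ^ (ρ * k + μ - 1) = (2 * R) ^ k * M ^ (μ - 1) := by
    rw [add_sub_assoc, Real.rpow_add hM, Real.rpow_mul hM.le, hMρ, Real.rpow_natCast]
  have hΓ := rpow_mul_exp_neg_le_Gamma hM hx
  rw [hpow] at hΓ
  rw [Real.norm_of_nonneg (by positivity)]
  calc ((k : ℝ) + 1) * R ^ k / |Real.Gamma (ρ * k + μ)|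
      ≤ ((k : ℝ) + 1) * R ^ k / ((2 * R) ^ k * M ^ (μ - 1) * Real.exp (-M)) := by
        gcongr
        exact hΓ.trans (le_abs_self _)
    _ = (M ^ (μ - 1) * Real.exp (-M))⁻¹ * (((k : ℝ) + 1) * (1 / 2 : ℝ) ^ k) := by
        rw [mul_pow, div_pow, one_pow]
        field_simp

/-- `E²_{ρ,μ}` is bounded on bounded sets. -/
theorem exists_norm_prabhakar_two_le {ρ : ℝ} (hρ : 0 < ρ) (μ : ℝ) {R : ℝ} (hR : 0 < R) :
    ∃ B : ℝ, 0 < B ∧ ∀ z : ℂ, ‖z‖ ≤ R → ‖prabhakar ρ μ 2 z‖ ≤ B := by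
  have hsum := summable_mul_pow_div_Gamma hρ μ hR
  refine ⟨(∑' k : ℕ, ((k : ℝ) + 1) * R ^ k / |Real.Gamma (ρ * k + μ)|) + 1, ?_, ?_⟩
  · have : 0 ≤ ∑' k : ℕ, ((k : ℝ) + 1) * R ^ k / |Real.Gamma (ρ * k + μ)| :=
      tsum_nonneg fun k => by positivity
    linarith
  · intro z hz
    refine (tsum_of_norm_bounded hsum.hasSum fun k => ?_).trans (le_add_of_nonneg_right zero_le_one)
    have hΓ : Real.Gamma (2 + k) / Real.Gamma 2 = ((k : ℝ) + 1) * (Nat.factorial k : ℝ) := by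
      have h := Real.Gamma_nat_eq_factorial (k + 1)
      rw [Nat.factorial_succ] at h
      push_cast at h
      rw [Real.Gamma_two, div_one, ← h]
      congr 1
      ring
    have hk : (0 : ℝ) < Nat.factorial k := by positivity
    rw [hΓ, norm_mul, norm_div, norm_mul, norm_pow, Complex.norm_real, Complex.norm_real,
      Complex.norm_natCast, Real.norm_of_nonneg (by positivity), Real.norm_eq_abs,
      mul_div_mul_right _ _ hk.ne', div_mul_eq_mul_div]
    gcongr

theorem intervalIntegrable_sub_rpow {p : ℝ} (hp : 0 < p) (t : ℝ) :
    IntervalIntegrable (fun τ : ℝ => (t - τ) ^ (p - 1)) MeasureTheory.volume 0 t := by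
  have h := (intervalIntegral.intervalIntegrable_rpow' (a := t) (b := 0) (r := p - 1)
    (by linarith)).comp_sub_left t
  simpa using h

theorem integral_sub_rpow {p : ℝ} (hp : 0 < p) (t : ℝ) :
    ∫ τ in (0 : ℝ)..t, (t - τ) ^ (p - 1) = t ^ p / p := by
  rw [intervalIntegral.integral_comp_sub_left (fun x : ℝ => x ^ (p - 1)),
    integral_rpow (Or.inl (by linarith))]
  simp [Real.zero_rpow hp.ne']

/-- A convolution integral dominated by a weakly singular power kernel is bounded on `[0, T]`. -/
theorem norm_integral_le_of_norm_le_sub_rpow {E : Type*} [NormedAddCommGroup E] [NormedSpace ℝ E]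
    {p t T K : ℝ} {f : ℝ → E} (hp : 0 < p) (ht0 : 0 ≤ t) (htT : t ≤ T) (hK : 0 ≤ K)
    (hf : ∀ τ ∈ Set.Ioc 0 t, ‖f τ‖ ≤ K * (t - τ) ^ (p - 1)) :
    ‖∫ τ in (0 : ℝ)..t, f τ‖ ≤ T ^ p / p * K := by
  calc ‖∫ τ in (0 : ℝ)..t, f τ‖
      ≤ ∫ τ in (0 : ℝ)..t, K * (t - τ) ^ (p - 1) :=
        intervalIntegral.norm_integral_le_of_norm_le ht0 (Filter.Eventually.of_forall hf)
          ((intervalIntegrable_sub_rpow hp t).const_mul K)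
    _ = t ^ p / p * K := by
        rw [intervalIntegral.integral_const_mul, integral_sub_rpow hp, mul_comm]
    _ ≤ T ^ p / p * K := by gcongr

/-- **Lemma 3.10**: for `0 < ρ < 1`, `α > 0`, `T > 0` and a continuous `H`-valued `g`, the
function `h(t) = ∫_0^t (t-τ)^(2ρ-1) E²_{ρ,2ρ}(-α(t-τ)^ρ) g(τ) dτ` satisfies
`‖h(t)‖ ≤ C max ‖g‖` and `‖J_t^{-ρ} h(t)‖ ≤ C max ‖g‖` on `[0,T]`, with `C = C(ρ,α,T)`. -/
theorem prabhakar_convolution_bounds {H : Type*} [NormedAddCommGroup H]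
    [NormedSpace ℂ H] [CompleteSpace H]
    (ρ α T : ℝ) (hρ0 : 0 < ρ) (hρ1 : ρ < 1) (hα : 0 < α) (hT : 0 < T) :
    ∃ C > 0, ∀ (g h : ℝ → H), ContinuousOn g (Set.Icc 0 T) →
      (∀ t, h t = ∫ τ in (0:ℝ)..t,
        ((((t - τ) ^ (2 * ρ - 1) : ℝ) : ℂ) *
          prabhakar ρ (2 * ρ) 2 (-(α : ℂ) * (((t - τ) ^ ρ : ℝ) : ℂ))) • g τ) →
      ∀ t ∈ Set.Icc (0:ℝ) T,
        ‖h t‖ ≤ C * (⨆ s : Set.Icc (0:ℝ) T, ‖g s‖) ∧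
        ‖fracInt ρ h t‖ ≤ C * (⨆ s : Set.Icc (0:ℝ) T, ‖g s‖) := by
  obtain ⟨B, hB, hBz⟩ := exists_norm_prabhakar_two_le hρ0 (2 * ρ)
    (R := α * T ^ ρ) (by positivity)
  have hΓ : 0 < Real.Gamma ρ := Real.Gamma_pos_of_pos hρ0
  set C₁ : ℝ := T ^ (2 * ρ) / (2 * ρ) * B
  set C₂ : ℝ := 1 / Real.Gamma ρ * (T ^ ρ / ρ * C₁)
  have hC₁ : 0 < C₁ := by positivity
  have hC₂ : 0 < C₂ := by positivity
  refine ⟨C₁ + C₂, by positivity, fun g h hg hh => ?_⟩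
  set G : ℝ := ⨆ s : Set.Icc (0 : ℝ) T, ‖g s‖
  have hG : 0 ≤ G := Real.iSup_nonneg fun _ => norm_nonneg _
  have hgG : ∀ s ∈ Set.Icc (0 : ℝ) T, ‖g s‖ ≤ G := by
    intro s hs
    have hbdd : BddAbove (Set.range fun s : Set.Icc (0 : ℝ) T => ‖g s‖) := by
      have := (isCompact_Icc.image_of_continuousOn hg.norm).bddAbove
      rwa [Set.image_eq_range] at this
    exact le_ciSup hbdd ⟨s, hs⟩
  have hbound : ∀ t ∈ Set.Icc (0 : ℝ) T, ‖h t‖ ≤ C₁ * G := by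
    intro t ht
    rw [hh t, mul_assoc]
    refine norm_integral_le_of_norm_le_sub_rpow (by positivity) ht.1 ht.2 (by positivity) ?_
    intro τ hτ
    have hsub : 0 ≤ t - τ := sub_nonneg.2 hτ.2
    have hz : ‖-(α : ℂ) * (((t - τ) ^ ρ : ℝ) : ℂ)‖ ≤ α * T ^ ρ := by
      rw [norm_mul, norm_neg, Complex.norm_real, Complex.norm_real, Real.norm_of_nonneg hα.le,
        Real.norm_of_nonneg (by positivity)]
      gcongr
      linarith [hτ.1, ht.2]
    rw [norm_smul, norm_mul, Complex.norm_real, Real.norm_of_nonneg (by positivity)]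
    calc (t - τ) ^ (2 * ρ - 1) * ‖prabhakar ρ (2 * ρ) 2 (-(α : ℂ) * (((t - τ) ^ ρ : ℝ) : ℂ))‖ *
          ‖g τ‖ ≤ (t - τ) ^ (2 * ρ - 1) * B * G := by
          gcongr
          · exact hBz _ hz
          · exact hgG τ ⟨hτ.1.le, hτ.2.trans ht.2⟩
      _ = B * G * (t - τ) ^ (2 * ρ - 1) := by ring
  intro t ht
  constructor
  · exact (hbound t ht).trans (by gcongr; linarith)
  · have hfrac : ‖fracInt ρ h t‖ ≤ C₂ * G := by
      rw [fracInt, norm_smul, Real.norm_of_nonneg (by positivity), mul_assoc, mul_assoc]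
      gcongr
      refine norm_integral_le_of_norm_le_sub_rpow hρ0 ht.1 ht.2 (by positivity) ?_
      intro ξ hξ
      have hsub : 0 ≤ t - ξ := sub_nonneg.2 hξ.2
      rw [norm_smul, Real.norm_of_nonneg (by positivity), mul_comm]
      gcongr
      exact hbound ξ ⟨hξ.1.le, hξ.2.trans ht.2⟩
    exact hfrac.trans (by gcongr; linarith)
end
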